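/- The Jaccard distance on finite sets satisfies the triangle inequality: for all finite sets A, B, C of elements of a common type, dJ(A, C) ≤ dJ(A, B) + dJ(B, C). -/

import Mathlib

open Finset
open scoped Classical

/-- Jaccard distance between finite sets, with the convention `0` when the union is empty. -/
noncomputable def jaccardDist {α : Type*} (A B : Finset α) : ℝ :=
  ((symmDiff A B).card : ℝ) / ((A ∪ B).card : ℝ)

/-- The Jaccard distance on finite sets satisfies the triangle inequality. -/
theorem jaccardDist_triangle {α : Type*} (A B C : Finset α) :
    jaccardDist A C ≤ jaccardDist A B + jaccardDist B C := by
  have key : ∀ X Y : Finset α, X ∪ Y ⊆ A ∪ B ∪ C →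
      ((symmDiff X Y).card : ℝ) / ((A ∪ B ∪ C).card : ℝ) ≤ jaccardDist X Y := by
    intro X Y h
    unfold jaccardDist
    rcases Nat.eq_zero_or_pos (X ∪ Y).card with h0 | h0
    · have h1 : symmDiff X Y = ∅ := by
        rw [Finset.card_eq_zero, Finset.union_eq_empty] at h0
        simp [h0.1, h0.2]
      simp [h1]
    · have h0' : (0 : ℝ) < ((X ∪ Y).card : ℝ) := by exact_mod_cast h0
      have h2 : ((X ∪ Y).card : ℝ) ≤ ((A ∪ B ∪ C).card : ℝ) := by
        exact_mod_cast Finset.card_le_card h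
      exact div_le_div_of_nonneg_left (by positivity) h0' h2
  have kAB := key A B (by grind)
  have kBC := key B C (by grind)
  have hN : (A ∪ B ∪ C).card = (A ∪ C).card + (B \ (A ∪ C)).card := by
    rw [← Finset.card_union_of_disjoint Finset.disjoint_sdiff]
    congr 1
    grind
  have hp : (symmDiff A C).card ≤ (A ∪ C).card :=
    Finset.card_le_card (fun x hx => by
      rw [Finset.mem_symmDiff] at hx
      grind)
  have hs : (symmDiff A C).card + (B \ (A ∪ C)).card
      ≤ (symmDiff A B).card + (symmDiff B C).card := by
    rw [← Finset.card_union_of_disjoint]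
    · refine le_trans (Finset.card_le_card ?_) (Finset.card_union_le _ _)
      intro x hx
      simp only [Finset.mem_union, Finset.mem_symmDiff, Finset.mem_sdiff] at hx ⊢
      tauto
    · rw [Finset.disjoint_left]
      intro x hx
      simp only [Finset.mem_union, Finset.mem_symmDiff, Finset.mem_sdiff] at hx ⊢
      tauto
  have hAC : jaccardDist A C ≤
      (((symmDiff A B).card : ℝ) + (symmDiff B C).card) / ((A ∪ B ∪ C).card : ℝ) := by
    unfold jaccardDist
    rcases Nat.eq_zero_or_pos (A ∪ C).card with h0 | h0
    · rw [h0]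
      simp only [Nat.cast_zero, div_zero]
      positivity
    · have h0' : (0 : ℝ) < ((A ∪ C).card : ℝ) := by exact_mod_cast h0
      have hN' : ((A ∪ B ∪ C).card : ℝ) = (A ∪ C).card + (B \ (A ∪ C)).card := by
        exact_mod_cast hN
      have hp' : ((symmDiff A C).card : ℝ) ≤ (A ∪ C).card := by exact_mod_cast hp
      have hs' : ((symmDiff A C).card : ℝ) + (B \ (A ∪ C)).card
          ≤ (symmDiff A B).card + (symmDiff B C).card := by exact_mod_cast hs
      have hb : (0 : ℝ) ≤ ((B \ (A ∪ C)).card : ℝ) := by positivity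
      rw [hN', div_le_div_iff₀ h0' (by linarith)]
      nlinarith [mul_le_mul_of_nonneg_right hp' hb, mul_le_mul_of_nonneg_right hs' h0'.le]
  rw [add_div] at hAC
  linarith
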